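/- arXiv:2111.02301 — 7 statements merged into one kernel-verified Lean document; each statement's English description precedes it below -/
import Mathlib

section
/- A finite group is isomorphic to a subgroup of the symmetric group S₄ on four letters or to a subgroup of the dihedral group D₆ of order 12 if and only if it is isomorphic to one of the following eleven groups: the trivial group, the cyclic groups C₂, C₃, C₄, C₆, the dihedral groups D₂ (Klein four-group, order 4), D₃ (order 6), D₄ (order 8), D₆ (order 12), the alternating group A₄, or the symmetric group S₄. -/
/-- A group of order 6 is cyclic or dihedral. -/
theorem order_six {G : Type*} [Group G] [Finite G] (hG : Nat.card G = 6) :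
    IsCyclic G ∨ Nonempty (G ≃* DihedralGroup 3) := by
  have : Fact (Nat.Prime 2) := ⟨Nat.prime_two⟩
  have : Fact (Nat.Prime 3) := ⟨Nat.prime_three⟩
  obtain ⟨a, ha⟩ := exists_prime_orderOf_dvd_card' (G := G) 3 (by rw [hG]; norm_num)
  obtain ⟨b, hb⟩ := exists_prime_orderOf_dvd_card' (G := G) 2 (by rw [hG]; norm_num)
  have ha3 : a ^ 3 = 1 := ha ▸ pow_orderOf_eq_one a
  have hb2 : b * b = 1 := by rw [← pow_two]; exact hb ▸ pow_orderOf_eq_one b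
  have hidx : (Subgroup.zpowers a).index = 2 := by
    have h := (Subgroup.zpowers a).card_mul_index
    rw [Nat.card_zpowers, ha, hG] at h
    omega
  have hn := Subgroup.normal_of_index_eq_two hidx
  have hmem := hn.conj_mem a (Subgroup.mem_zpowers a) b
  rw [← mem_powers_iff_mem_zpowers, Submonoid.mem_powers_iff] at hmem
  obtain ⟨k, hk⟩ := hmem
  rw [← pow_mod_orderOf, ha] at hk
  have hk3 : k % 3 < 3 := Nat.mod_lt _ (by norm_num)
  have hbn1 : b ≠ 1 := by rintro rfl; simp at hb
  have han1 : a ≠ 1 := by rintro rfl; simp at ha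
  generalize k % 3 = m at hk hk3
  interval_cases m
  · exfalso
    rw [pow_zero] at hk
    exact han1 (by simpa using hk.symm)
  · left
    have hc : Commute a b := by
      rw [pow_one, eq_mul_inv_iff_mul_eq] at hk
      exact hk
    have ho : orderOf (a * b) = 6 := by
      rw [hc.orderOf_mul_eq_mul_orderOf_of_coprime (by rw [ha, hb]; norm_num), ha, hb]
    exact isCyclic_of_orderOf_eq_card (a * b) (by rw [ho, hG])
  · right
    have hinv : b * a * b⁻¹ = a⁻¹ := by
      rw [← hk, eq_inv_iff_mul_eq_one, ← pow_succ, ha3]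
    let f : ZMod 3 → G := fun i => a ^ i.val
    have hfadd : ∀ i j, f (i + j) = f i * f j := by
      intro i j
      change a ^ (i + j).val = a ^ i.val * a ^ j.val
      rw [← pow_add, ZMod.val_add, ← pow_mod_orderOf a (i.val + j.val), ha]
    have hf0 : f 0 = 1 := by simp [f]
    have hfneg : ∀ i, f (-i) = (f i)⁻¹ := by
      intro i
      rw [eq_inv_iff_mul_eq_one, ← hfadd, neg_add_cancel, hf0]
    have hfb : ∀ i, f i * b = b * f (-i) := by
      intro i
      have h : b * f i * b⁻¹ = (f i)⁻¹ := by
        change b * a ^ i.val * b⁻¹ = (a ^ i.val)⁻¹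
        rw [← conj_pow, hinv, inv_pow]
      have h' : b * (f i)⁻¹ * b⁻¹ = f i := by
        rw [← conj_inv, h, inv_inv]
      rw [hfneg, ← eq_mul_inv_iff_mul_eq]
      exact h'.symm
    have hfinj : ∀ i, f i = 1 → i = 0 := by
      intro i hi
      have h := orderOf_dvd_of_pow_eq_one hi
      rw [ha] at h
      have h0 := Nat.eq_zero_of_dvd_of_lt h i.val_lt
      exact (ZMod.val_eq_zero i).1 h0
    have hf3 : ∀ i, f i ^ 3 = 1 := by
      intro i
      change (a ^ i.val) ^ 3 = 1
      rw [← pow_mul, mul_comm, pow_mul, ha3, one_pow]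
    let F : DihedralGroup 3 → G := fun x => match x with
      | .r i => f i
      | .sr i => b * f i
    have hF : ∀ x y, F (x * y) = F x * F y := by
      rintro (i | i) (j | j)
      · exact hfadd i j
      · change b * f (j - i) = f i * (b * f j)
        rw [← mul_assoc, hfb, mul_assoc, ← hfadd, neg_add_eq_sub]
      · change b * f (i + j) = b * f i * f j
        rw [hfadd, mul_assoc]
      · change f (j - i) = b * f i * (b * f j)
        rw [mul_assoc b, ← mul_assoc (f i), hfb, mul_assoc b, ← hfadd, ← mul_assoc, hb2,
          one_mul, neg_add_eq_sub]
    let φ : DihedralGroup 3 →* G := MonoidHom.mk' F hF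
    have hinj : Function.Injective φ := by
      rw [injective_iff_map_eq_one]
      rintro (i | i) hi
      · change f i = 1 at hi
        rw [hfinj i hi]; rfl
      · exfalso
        change b * f i = 1 at hi
        have hbi := eq_inv_of_mul_eq_one_left hi
        have : b ^ 3 = 1 := by rw [hbi, inv_pow, hf3, inv_one]
        rw [pow_succ, pow_two, hb2, one_mul] at this
        exact hbn1 this
    have hbij : Function.Bijective φ := by
      have := Fintype.ofFinite G
      rw [Fintype.bijective_iff_injective_and_card]
      refine ⟨hinj, ?_⟩
      rw [← Nat.card_eq_fintype_card, ← Nat.card_eq_fintype_card, hG, DihedralGroup.nat_card]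
    exact ⟨(MulEquiv.ofBijective φ hbij).symm⟩

/-- A group of order 4 is cyclic or Klein. -/
theorem order_four {G : Type*} [Group G] [Finite G] (hG : Nat.card G = 4) :
    IsCyclic G ∨ Nonempty (G ≃* DihedralGroup 2) := by
  by_cases h : IsCyclic G
  · exact Or.inl h
  · right
    have : IsKleinFour G :=
      ⟨hG, (not_isCyclic_iff_exponent_eq_prime Nat.prime_two (by rw [hG]; norm_num)).1 h⟩
    exact IsKleinFour.nonempty_mulEquiv

theorem cyclic_equiv {G : Type*} [Group G] {n : ℕ} (h : IsCyclic G) (hG : Nat.card G = n) :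
    Nonempty (G ≃* Multiplicative (ZMod n)) := by
  subst hG
  exact ⟨(zmodCyclicMulEquiv h).symm⟩

/-- The embedding of `D₄` in `S₄`. -/
def dFour : DihedralGroup 4 → Equiv.Perm (Fin 4)
  | .r i => (finRotate 4) ^ i.val
  | .sr i => Equiv.swap 0 2 * (finRotate 4) ^ i.val

theorem dFour_mul : ∀ x y, dFour (x * y) = dFour x * dFour y := by
  rintro (i | i) (j | j) <;> revert i j <;> decide

theorem dFour_inj : Function.Injective (MonoidHom.mk' dFour dFour_mul) := by
  rw [injective_iff_map_eq_one]
  rintro (i | i) <;> revert i <;> decide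

/-- The embedding of `D₂` in `D₆`. -/
def dTwo : DihedralGroup 2 → DihedralGroup 6
  | .r i => .r (3 * i.val)
  | .sr i => .sr (3 * i.val)

theorem dTwo_mul : ∀ x y, dTwo (x * y) = dTwo x * dTwo y := by
  rintro (i | i) (j | j) <;> revert i j <;> decide

theorem dTwo_inj : Function.Injective (MonoidHom.mk' dTwo dTwo_mul) := by
  rw [injective_iff_map_eq_one]
  rintro (i | i) <;> revert i <;> decide

/-- The embedding of `D₃` in `D₆`. -/
def dThree : DihedralGroup 3 → DihedralGroup 6
  | .r i => .r (2 * i.val)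
  | .sr i => .sr (2 * i.val)

theorem dThree_mul : ∀ x y, dThree (x * y) = dThree x * dThree y := by
  rintro (i | i) (j | j) <;> revert i j <;> decide

theorem dThree_inj : Function.Injective (MonoidHom.mk' dThree dThree_mul) := by
  rw [injective_iff_map_eq_one]
  rintro (i | i) <;> revert i <;> decide

theorem embed {G K L : Type*} [Group G] [Group K] [Group L] (e : G ≃* K) (φ : K →* L)
    (h : Function.Injective φ) : ∃ H : Subgroup L, Nonempty (G ≃* H) :=
  ⟨φ.range, ⟨e.trans (MonoidHom.ofInjective h)⟩⟩

theorem embed_cyclic {G L : Type*} [Group G] [Group L] {n : ℕ}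
    (e : G ≃* Multiplicative (ZMod n)) (g : L) (h : orderOf g = n) :
    ∃ H : Subgroup L, Nonempty (G ≃* H) := by
  refine ⟨Subgroup.zpowers g, ?_⟩
  obtain ⟨e'⟩ := cyclic_equiv (G := Subgroup.zpowers g) inferInstance (n := n)
    (by rw [Nat.card_zpowers, h])
  exact ⟨e.trans e'.symm⟩

theorem small_order {G : Type*} [Group G] [Finite G] {n : ℕ} (hG : Nat.card G = n)
    (hn : n = 1 ∨ n = 2 ∨ n = 3 ∨ n = 4 ∨ n = 6) :
    Nonempty (G ≃* Multiplicative (ZMod 1)) ∨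
      Nonempty (G ≃* Multiplicative (ZMod 2)) ∨
      Nonempty (G ≃* Multiplicative (ZMod 3)) ∨
      Nonempty (G ≃* Multiplicative (ZMod 4)) ∨
      Nonempty (G ≃* Multiplicative (ZMod 6)) ∨
      Nonempty (G ≃* DihedralGroup 2) ∨
      Nonempty (G ≃* DihedralGroup 3) := by
  rcases hn with rfl | rfl | rfl | rfl | rfl
  · have : Subsingleton G := (Nat.card_eq_one_iff_unique.1 hG).1
    exact Or.inl (cyclic_equiv inferInstance hG)
  · have : Fact (Nat.Prime 2) := ⟨Nat.prime_two⟩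
    exact Or.inr (Or.inl (cyclic_equiv (isCyclic_of_prime_card hG) hG))
  · have : Fact (Nat.Prime 3) := ⟨Nat.prime_three⟩
    exact Or.inr (Or.inr (Or.inl (cyclic_equiv (isCyclic_of_prime_card hG) hG)))
  · rcases order_four hG with h | h
    · have := cyclic_equiv h hG
      tauto
    · tauto
  · rcases order_six hG with h | h
    · have := cyclic_equiv h hG
      tauto
    · tauto

theorem order_eight (H : Subgroup (Equiv.Perm (Fin 4))) (hH : Nat.card H = 8) :
    Nonempty (H ≃* DihedralGroup 4) := by
  have : Fact (Nat.Prime 2) := ⟨Nat.prime_two⟩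
  have hfac : 2 ^ (Nat.card (Equiv.Perm (Fin 4))).factorization 2 = 8 := by
    have h1 : Nat.card (Equiv.Perm (Fin 4)) = 2 ^ 3 * 3 := by
      rw [Nat.card_perm, Nat.card_fin]; rfl
    rw [h1, Nat.factorization_mul (by norm_num) (by norm_num), Nat.factorization_pow]
    simp [Nat.Prime.factorization Nat.prime_two, Nat.Prime.factorization Nat.prime_three]
  let e := MonoidHom.ofInjective dFour_inj
  let P := Sylow.ofCard H (p := 2) (hH.trans hfac.symm)
  let Q := Sylow.ofCard (MonoidHom.mk' dFour dFour_mul).range (p := 2)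
    (by rw [hfac, ← Nat.card_congr e.toEquiv, DihedralGroup.nat_card])
  exact ⟨(Sylow.equiv P Q).trans e.symm⟩

/-- a finite group is isomorphic to a subgroup of S₄ or to a subgroup of
the dihedral group D₆ of order 12 iff it is isomorphic to one of the eleven groups
1, C₂, C₃, C₄, C₆, D₂, D₃, D₄, D₆, A₄, S₄. -/
theorem stmt1 (G : Type*) [Group G] [Finite G] :
    ((∃ H : Subgroup (Equiv.Perm (Fin 4)), Nonempty (G ≃* H)) ∨
      (∃ H : Subgroup (DihedralGroup 6), Nonempty (G ≃* H))) ↔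
    (Nonempty (G ≃* Multiplicative (ZMod 1)) ∨
      Nonempty (G ≃* Multiplicative (ZMod 2)) ∨
      Nonempty (G ≃* Multiplicative (ZMod 3)) ∨
      Nonempty (G ≃* Multiplicative (ZMod 4)) ∨
      Nonempty (G ≃* Multiplicative (ZMod 6)) ∨
      Nonempty (G ≃* DihedralGroup 2) ∨
      Nonempty (G ≃* DihedralGroup 3) ∨
      Nonempty (G ≃* DihedralGroup 4) ∨
      Nonempty (G ≃* DihedralGroup 6) ∨
      Nonempty (G ≃* alternatingGroup (Fin 4)) ∨
      Nonempty (G ≃* Equiv.Perm (Fin 4))) := by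
  constructor
  · rintro (⟨H, ⟨e⟩⟩ | ⟨H, ⟨e⟩⟩)
    · have hdvd := H.card_subgroup_dvd_card
      have h24 : Nat.card (Equiv.Perm (Fin 4)) = 24 := by
        rw [Nat.card_perm, Nat.card_fin]; rfl
      have hidx := H.card_mul_index
      have hGH : Nat.card G = Nat.card H := Nat.card_congr e.toEquiv
      rw [h24] at hdvd hidx
      have hmem : Nat.card H ∈ Nat.divisors 24 := Nat.mem_divisors.2 ⟨hdvd, by norm_num⟩
      have hdiv : Nat.divisors 24 = {1, 2, 3, 4, 6, 8, 12, 24} := by decide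
      rw [hdiv] at hmem
      simp only [Finset.mem_insert, Finset.mem_singleton] at hmem
      by_cases hs : Nat.card H = 1 ∨ Nat.card H = 2 ∨ Nat.card H = 3 ∨ Nat.card H = 4 ∨
          Nat.card H = 6
      · rcases small_order hGH hs with h | h | h | h | h | h | h <;> simp only [h, true_or, or_true]
      · have hbig : Nat.card H = 8 ∨ Nat.card H = 12 ∨ Nat.card H = 24 := by omega
        rcases hbig with h | h | h
        · obtain ⟨e'⟩ := order_eight H h
          have hne : Nonempty (G ≃* DihedralGroup 4) := ⟨e.trans e'⟩
          simp only [hne, true_or, or_true]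
        · rw [h] at hidx
          have hH := Equiv.Perm.eq_alternatingGroup_of_index_eq_two
            (G := H) (by omega)
          subst hH
          have hne : Nonempty (G ≃* alternatingGroup (Fin 4)) := ⟨e⟩
          simp only [hne, true_or, or_true]
        · have hH : H = ⊤ := Subgroup.eq_top_of_card_eq H (h.trans h24.symm)
          subst hH
          have hne : Nonempty (G ≃* Equiv.Perm (Fin 4)) := ⟨e.trans Subgroup.topEquiv⟩
          simp only [hne, true_or, or_true]
    · have hdvd := H.card_subgroup_dvd_card
      have h12 : Nat.card (DihedralGroup 6) = 12 := DihedralGroup.nat_card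
      have hGH : Nat.card G = Nat.card H := Nat.card_congr e.toEquiv
      rw [h12] at hdvd
      have hmem : Nat.card H ∈ Nat.divisors 12 := Nat.mem_divisors.2 ⟨hdvd, by norm_num⟩
      have hdiv : Nat.divisors 12 = {1, 2, 3, 4, 6, 12} := by decide
      rw [hdiv] at hmem
      simp only [Finset.mem_insert, Finset.mem_singleton] at hmem
      by_cases hs : Nat.card H = 1 ∨ Nat.card H = 2 ∨ Nat.card H = 3 ∨ Nat.card H = 4 ∨
          Nat.card H = 6
      · rcases small_order hGH hs with h | h | h | h | h | h | h <;> simp only [h, true_or, or_true]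
      · have h : Nat.card H = 12 := by omega
        have hH : H = ⊤ := Subgroup.eq_top_of_card_eq H (h.trans h12.symm)
        subst hH
        have hne : Nonempty (G ≃* DihedralGroup 6) := ⟨e.trans Subgroup.topEquiv⟩
        simp only [hne, true_or, or_true]
  · rintro (e | e | e | e | e | e | e | e | e | e | e) <;> obtain ⟨e⟩ := e
    · exact Or.inr (embed_cyclic e 1 orderOf_one)
    · exact Or.inr (embed_cyclic e (DihedralGroup.sr 0) (DihedralGroup.orderOf_sr 0))
    · exact Or.inr (embed_cyclic e (DihedralGroup.r 2)
        (by rw [DihedralGroup.orderOf_r]; decide))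
    · exact Or.inl (embed_cyclic e (MonoidHom.mk' dFour dFour_mul (DihedralGroup.r 1))
        (by rw [orderOf_injective _ dFour_inj, DihedralGroup.orderOf_r_one]))
    · exact Or.inr (embed_cyclic e (DihedralGroup.r 1) DihedralGroup.orderOf_r_one)
    · exact Or.inr (embed e _ dTwo_inj)
    · exact Or.inr (embed e _ dThree_inj)
    · exact Or.inl (embed e _ dFour_inj)
    · exact Or.inr (embed e (MonoidHom.id _) Function.injective_id)
    · exact Or.inl ⟨_, ⟨e⟩⟩
    · exact Or.inl (embed e (MonoidHom.id _) Function.injective_id)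
end

section
/- Let (M,d) be a metric space equipped with a Borel measure μ such that every closed ball of positive radius has positive finite measure, and suppose that for some n ∈ ℕ the Bishop–Gromov volume comparison holds: μ(B̄(p,R)) ≤ (R/r)ⁿ · μ(B̄(p,r)) for every p ∈ M and every 0 < r ≤ R. Then for every α ∈ (0,1), every d > 0, and every finite nonempty subset X ⊆ M of diameter at most d, there exists a subset T ⊆ X with |T| ≤ (1 + 8/α)ⁿ such that X is contained in the union of the closed balls of radius αd/4 centred at the points of T. -/
open Metric MeasureTheory

/-- in a metric measure space satisfying an `n`-dimensional Bishop–Gromov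
volume comparison, every finite set of diameter at most `d` admits a covering by at most
`(1 + 8/α)^n` closed balls of radius `α d / 4` centred at points of the set. -/
theorem stmt6 {M : Type*} [MetricSpace M] [MeasurableSpace M] [OpensMeasurableSpace M]
    (μ : Measure M) (n : ℕ)
    (hpos : ∀ (p : M) (r : ℝ), 0 < r → 0 < μ (closedBall p r) ∧ μ (closedBall p r) < ⊤)
    (hBG : ∀ (p : M) (r R : ℝ), 0 < r → r ≤ R →
      μ (closedBall p R) ≤ ENNReal.ofReal ((R / r) ^ n) * μ (closedBall p r))
    (α : ℝ) (hα : α ∈ Set.Ioo (0 : ℝ) 1) (d : ℝ) (hd : 0 < d)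
    (X : Finset M) (hX : X.Nonempty) (hdiam : ∀ x ∈ X, ∀ y ∈ X, dist x y ≤ d) :
    ∃ T : Finset M, T ⊆ X ∧ (T.card : ℝ) ≤ (1 + 8 / α) ^ n ∧
      ∀ x ∈ X, ∃ t ∈ T, dist x t ≤ α * d / 4 := by
  classical
  obtain ⟨hα0, hα1⟩ := hα
  obtain ⟨T, hT, hmax⟩ := Finset.exists_max_image
    (X.powerset.filter (fun S => ∀ x ∈ S, ∀ y ∈ S, x ≠ y → α * d / 4 < dist x y))
    Finset.card ⟨∅, by simp⟩
  rw [Finset.mem_filter, Finset.mem_powerset] at hT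
  obtain ⟨hTX, hsep⟩ := hT
  have hr : 0 < α * d / 8 := by positivity
  have hcov : ∀ x ∈ X, ∃ t ∈ T, dist x t ≤ α * d / 4 := by
    intro x hx
    by_contra hcon
    push Not at hcon
    have hxT : x ∉ T := fun h => by
      have := hcon x h
      rw [dist_self] at this
      linarith
    have := hmax (insert x T) (by
      rw [Finset.mem_filter, Finset.mem_powerset]
      refine ⟨Finset.insert_subset hx hTX, ?_⟩
      intro a ha b hb hab
      rw [Finset.mem_insert] at ha hb
      rcases ha with rfl | ha <;> rcases hb with rfl | hb
      · exact absurd rfl hab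
      · exact hcon b hb
      · rw [dist_comm]; exact hcon a ha
      · exact hsep a ha b hb hab)
    rw [Finset.card_insert_of_notMem hxT] at this
    omega
  refine ⟨T, hTX, ?_, hcov⟩
  obtain ⟨x, hx⟩ := hX
  obtain ⟨t, ht, -⟩ := hcov x hx
  obtain ⟨t0, ht0, hmin⟩ := Finset.exists_min_image T
    (fun t => μ (closedBall t (α * d / 8))) ⟨t, ht⟩
  have h1 : (T.card : ENNReal) * μ (closedBall t0 (α * d / 8)) ≤
      ∑ t ∈ T, μ (closedBall t (α * d / 8)) := by
    rw [← nsmul_eq_mul]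
    exact Finset.card_nsmul_le_sum _ _ _ hmin
  have h2 : ∑ t ∈ T, μ (closedBall t (α * d / 8)) =
      μ (⋃ t ∈ T, closedBall t (α * d / 8)) := by
    rw [measure_biUnion_finset]
    · intro a ha b hb hab
      apply closedBall_disjoint_closedBall
      have := hsep a ha b hb hab
      linarith
    · intro a _
      exact isClosed_closedBall.measurableSet
  have h3 : (⋃ t ∈ T, closedBall t (α * d / 8)) ⊆ closedBall t0 (d + α * d / 8) := by
    refine Set.iUnion₂_subset fun a ha => closedBall_subset_closedBall' ?_
    have := hdiam a (hTX ha) t0 (hTX ht0)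
    linarith
  have h4 := (h1.trans_eq h2).trans ((measure_mono h3).trans
    (hBG t0 (α * d / 8) (d + α * d / 8) hr (by linarith)))
  obtain ⟨hp, hf⟩ := hpos t0 _ hr
  have h5 := (ENNReal.mul_le_mul_iff_left hp.ne' hf.ne).1 h4
  have h6 : (d + α * d / 8) / (α * d / 8) = 1 + 8 / α := by
    field_simp
    ring
  rw [h6, ← ENNReal.ofReal_natCast] at h5
  exact (ENNReal.ofReal_le_ofReal_iff (by positivity)).1 h5
end

section
/- Let (M,d) be a metric space, α ∈ (0,1), and k ≥ 1 an integer, and suppose that for every D > 0 every finite subset of M of diameter at most D can be covered by at most k closed balls of radius αD/4. Then for every finite subset S ⊆ M with |S| ≥ 2 and diam S = d, there exist a point x ∈ S and a subset S′ ⊆ S such that d(x,y) ≥ d/2 for every y ∈ S′, diam S′ ≤ αd/2, and |S′| ≥ |S|/(2k). -/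
open Metric

/-- one step of the shrinking-sequence construction. If every finite subset of
diameter at most `D` can be covered by at most `k` closed balls of radius `α D / 4`, then any
finite set `S` with `|S| ≥ 2` and `diam S = d` contains a point `x` and a subset `S'` with
`d(x, S') ≥ d/2`, `diam S' ≤ α d / 2`, and `|S'| ≥ |S| / (2k)`. -/
theorem stmt7 {M : Type*} [MetricSpace M] (α : ℝ) (hα : α ∈ Set.Ioo (0 : ℝ) 1)
    (k : ℕ) (hk : 1 ≤ k)
    (hcov : ∀ D : ℝ, 0 < D → ∀ X : Finset M, (∀ x ∈ X, ∀ y ∈ X, dist x y ≤ D) →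
      ∃ T : Finset M, T.card ≤ k ∧ ∀ x ∈ X, ∃ t ∈ T, dist x t ≤ α * D / 4)
    (S : Finset M) (hS : 2 ≤ S.card) (d : ℝ) (hd : d = Metric.diam (S : Set M)) :
    ∃ x ∈ S, ∃ S' ⊆ S,
      (∀ y ∈ S', d / 2 ≤ dist x y) ∧
      Metric.diam (S' : Set M) ≤ α * d / 2 ∧
      (S.card : ℝ) / (2 * k) ≤ S'.card := by
  classical
  obtain ⟨hα0, -⟩ := hα
  have hbd : Bornology.IsBounded (S : Set M) := S.finite_toSet.isBounded
  have hle : ∀ x ∈ S, ∀ y ∈ S, dist x y ≤ d := fun x hx y hy => by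
    rw [hd]; exact Metric.dist_le_diam_of_mem hbd hx hy
  obtain ⟨u, hu, v, hv, huv⟩ := Finset.one_lt_card.mp (show 1 < S.card by omega)
  have hd0 : 0 < d := lt_of_lt_of_le (dist_pos.mpr huv) (hle u hu v hv)
  obtain ⟨⟨a, b⟩, hab, hmax⟩ := Finset.exists_max_image (S ×ˢ S) (fun p => dist p.1 p.2)
    ⟨(u, v), Finset.mk_mem_product hu hv⟩
  obtain ⟨ha, hb⟩ := Finset.mem_product.mp hab
  simp only at ha hb hmax
  have hdab : d ≤ dist a b := by
    rw [hd]
    exact Metric.diam_le_of_forall_dist_le dist_nonneg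
      (fun x hx y hy => hmax (x, y) (Finset.mk_mem_product hx hy))
  obtain ⟨x, hx, hxc⟩ : ∃ x ∈ S, S.card ≤ 2 * (S.filter (fun y => d / 2 ≤ dist x y)).card := by
    have hsub : S ⊆ S.filter (fun y => d / 2 ≤ dist a y) ∪
        S.filter (fun y => d / 2 ≤ dist b y) := by
      intro y hy
      simp only [Finset.mem_union, Finset.mem_filter, hy, true_and]
      by_contra! h
      have := dist_triangle_right a b y
      linarith [h.1, h.2]
    have h1 := (Finset.card_le_card hsub).trans (Finset.card_union_le _ _)
    by_contra! h
    have := h a ha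
    have := h b hb
    omega
  set A := S.filter (fun y => d / 2 ≤ dist x y) with hA
  have hAS : A ⊆ S := Finset.filter_subset _ _
  obtain ⟨T, hT, hc⟩ := hcov d hd0 S hle
  choose! f hf hfd using hc
  have hTne : T.Nonempty := ⟨f u, hf u hu⟩
  have hk0 : (0 : ℝ) < k := by exact_mod_cast hk
  have hcard : T.card • ((S.card : ℝ) / (2 * k)) ≤ A.card := by
    have h1 : (T.card : ℝ) ≤ k := by exact_mod_cast hT
    have h2 : (S.card : ℝ) ≤ 2 * A.card := by exact_mod_cast hxc
    rw [nsmul_eq_mul]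
    calc (T.card : ℝ) * ((S.card : ℝ) / (2 * k)) ≤ k * ((S.card : ℝ) / (2 * k)) := by gcongr
      _ = S.card / 2 := by field_simp
      _ ≤ A.card := by linarith
  obtain ⟨t, ht, htc⟩ := Finset.exists_le_card_fiber_of_nsmul_le_card_of_maps_to
    (f := f) (fun y hy => hf y (hAS hy)) hTne hcard
  refine ⟨x, hx, A.filter (fun y => f y = t), (Finset.filter_subset _ _).trans hAS, ?_, ?_, htc⟩
  · intro y hy
    exact (Finset.mem_filter.mp (Finset.mem_filter.mp hy).1).2
  · refine Metric.diam_le_of_forall_dist_le (by positivity) ?_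
    intro y hy z hz
    obtain ⟨hy1, hy2⟩ := Finset.mem_filter.mp (Finset.mem_coe.mp hy)
    obtain ⟨hz1, hz2⟩ := Finset.mem_filter.mp (Finset.mem_coe.mp hz)
    have h1 := hfd y (hAS hy1)
    have h2 := hfd z (hAS hz1)
    rw [hy2] at h1
    rw [hz2] at h2
    linarith [dist_triangle_right y z t]
end

section
/- Let (M,d) be a metric space, α ∈ (0,1), and k ≥ 1 an integer, and suppose that for every D > 0 every finite subset of M of diameter at most D can be covered by at most k closed balls of radius αD/4. Let m ≥ 3 be an integer. Then every subset S ⊆ M with |S| ≥ 2·(2k)^{m−2} contains m pairwise distinct points x₁,…,x_m satisfying d(x_{i+1}, x_{i+2}) ≤ α · d(x_i, x_{i+1}) for every i ∈ {1,…,m−2}. -/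
open Metric

theorem chain_aux {M : Type*} [MetricSpace M] (α : ℝ) (hα : α ∈ Set.Ioo (0 : ℝ) 1)
    (k : ℕ)
    (hcov : ∀ D : ℝ, 0 < D → ∀ X : Finset M, (∀ x ∈ X, ∀ y ∈ X, dist x y ≤ D) →
      ∃ T : Finset M, T.card ≤ k ∧ ∀ x ∈ X, ∃ t ∈ T, dist x t ≤ α * D / 4)
    (hk : 1 ≤ k) (n : ℕ) : ∀ S : Finset M, 2 * (2 * k) ^ n ≤ S.card →
    ∃ x : ℕ → M,
      (∀ i, i ≤ n + 1 → x i ∈ S) ∧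
      (∀ i j, i < j → j ≤ n + 1 → x i ≠ x j) ∧
      (∀ i, i + 2 ≤ n + 1 → dist (x (i + 1)) (x (i + 2)) ≤ α * dist (x i) (x (i + 1))) := by
  classical
  induction n with
  | zero =>
    intro S hS
    obtain ⟨a, ha, b, hb, hab⟩ := Finset.one_lt_card.1 (show 1 < S.card by simp at hS; omega)
    refine ⟨fun i => if i = 0 then a else b, ?_, ?_, ?_⟩
    · intro i _
      dsimp only
      split_ifs <;> assumption
    · intro i j hij hj
      have h1 : i = 0 := by omega
      have h2 : j ≠ 0 := by omega
      simpa [h1, h2] using hab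
    · intro i hi
      omega
  | succ n ih =>
    intro S hS
    have hpos : 1 ≤ (2 * k) ^ n := Nat.one_le_pow _ _ (by omega)
    have hS1 : 1 < S.card := by
      have : 1 ≤ (2 * k) ^ (n + 1) := Nat.one_le_pow _ _ (by omega)
      omega
    obtain ⟨a, ha, b, hb, hab⟩ := Finset.one_lt_card.1 hS1
    obtain ⟨⟨p, q⟩, hpq, hmax⟩ := Finset.exists_max_image (S ×ˢ S) (fun z => dist z.1 z.2)
      ⟨(a, b), Finset.mem_product.2 ⟨ha, hb⟩⟩
    obtain ⟨hp, hq⟩ := Finset.mem_product.1 hpq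
    dsimp only at hp hq
    have hmax' : ∀ x ∈ S, ∀ y ∈ S, dist x y ≤ dist p q := fun x hx y hy =>
      hmax (x, y) (Finset.mem_product.2 ⟨hx, hy⟩)
    have hD : 0 < dist p q := lt_of_lt_of_le (dist_pos.2 hab) (hmax' a ha b hb)
    obtain ⟨T, hT, hTc⟩ := hcov _ hD S hmax'
    set D := dist p q with hDdef
    choose! f hfT hf using hTc
    have hmaps : ∀ x ∈ S, (f x, decide (D / 2 ≤ dist p x)) ∈ T ×ˢ (Finset.univ : Finset Bool) :=
      fun x hx => Finset.mem_product.2 ⟨hfT x hx, Finset.mem_univ _⟩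
    have hcard : (T ×ˢ (Finset.univ : Finset Bool)).card * (2 * (2 * k) ^ n) ≤ S.card := by
      rw [Finset.card_product]
      simp only [Finset.card_univ, Fintype.card_bool]
      calc T.card * 2 * (2 * (2 * k) ^ n) ≤ k * 2 * (2 * (2 * k) ^ n) := by gcongr
        _ = 2 * (2 * k) ^ (n + 1) := by ring
        _ ≤ _ := hS
    obtain ⟨⟨t, c⟩, _, hY⟩ := Finset.exists_le_card_fiber_of_mul_le_card_of_maps_to hmaps
      ⟨_, hmaps a ha⟩ hcard
    obtain ⟨x, hxS, hxd, hxr⟩ := ih _ hY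
    have hx : ∀ i, i ≤ n + 1 → x i ∈ S ∧ f (x i) = t ∧ decide (D / 2 ≤ dist p (x i)) = c := by
      intro i hi
      simpa using hxS i hi
    have hdiam : ∀ i j, i ≤ n + 1 → j ≤ n + 1 → dist (x i) (x j) ≤ α * (D / 2) := by
      intro i j hi hj
      obtain ⟨h1, h2, _⟩ := hx i hi
      obtain ⟨h3, h4, _⟩ := hx j hj
      have h5 := hf _ h1
      have h6 := hf _ h3
      rw [h2] at h5
      rw [h4] at h6
      have := dist_triangle_right (x i) (x j) t
      linarith
    obtain ⟨r, hr, hfar⟩ : ∃ r ∈ S, ∀ i, i ≤ n + 1 → D / 2 ≤ dist r (x i) := by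
      cases c with
      | true => exact ⟨p, hp, fun i hi => by simpa using (hx i hi).2.2⟩
      | false =>
        refine ⟨q, hq, fun i hi => ?_⟩
        have h1 : dist p (x i) < D / 2 := by simpa using (hx i hi).2.2
        have := dist_triangle_right p q (x i)
        linarith
    refine ⟨fun i => if i = 0 then r else x (i - 1), ?_, ?_, ?_⟩
    · intro i hi
      dsimp only
      split_ifs
      · exact hr
      · exact (hx _ (by omega)).1
    · intro i j hij hj
      have hj0 : j ≠ 0 := by omega
      by_cases hi : i = 0
      · simp only [hi, hj0, if_true, if_false]
        have := hfar (j - 1) (by omega)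
        exact dist_pos.1 (by linarith)
      · simp only [hi, hj0, if_false]
        exact hxd _ _ (by omega) (by omega)
    · intro i hi
      cases i with
      | zero =>
        have h1 := hdiam 0 1 (by omega) (by omega)
        have h2 := mul_le_mul_of_nonneg_left (hfar 0 (by omega)) hα.1.le
        simpa using h1.trans h2
      | succ i => simpa using hxr i (by omega)

/-- if every finite subset of diameter at most `D` can be covered by at most
`k` closed balls of radius `α D / 4`, then every subset `S` with `|S| ≥ 2 (2k)^(m-2)`
contains distinct points `x₁, …, x_m` with `d(x_{i+1}, x_{i+2}) ≤ α d(x_i, x_{i+1})`. -/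
theorem stmt8 {M : Type*} [MetricSpace M] (α : ℝ) (hα : α ∈ Set.Ioo (0 : ℝ) 1)
    (k : ℕ) (hk : 1 ≤ k)
    (hcov : ∀ D : ℝ, 0 < D → ∀ X : Finset M, (∀ x ∈ X, ∀ y ∈ X, dist x y ≤ D) →
      ∃ T : Finset M, T.card ≤ k ∧ ∀ x ∈ X, ∃ t ∈ T, dist x t ≤ α * D / 4)
    (m : ℕ) (hm : 3 ≤ m) (S : Set M)
    (hS : (2 * (2 * k) ^ (m - 2) : ℕ∞) ≤ S.encard) :
    ∃ x : ℕ → M,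
      (∀ i, 1 ≤ i → i ≤ m → x i ∈ S) ∧
      (∀ i j, 1 ≤ i → i < j → j ≤ m → x i ≠ x j) ∧
      (∀ i, 1 ≤ i → i + 2 ≤ m → dist (x (i + 1)) (x (i + 2)) ≤ α * dist (x i) (x (i + 1))) := by
  obtain ⟨A, hAS, hA⟩ := Set.exists_subset_encard_eq hS
  have hfin : A.Finite := by
    refine Set.finite_of_encard_eq_coe (k := 2 * (2 * k) ^ (m - 2)) ?_
    rw [hA]
    push_cast
    rfl
  have hc : 2 * (2 * k) ^ (m - 2) ≤ hfin.toFinset.card := by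
    rw [hfin.encard_eq_coe_toFinset_card] at hA
    exact_mod_cast hA.ge
  obtain ⟨x, h1, h2, h3⟩ := chain_aux α hα k hcov hk (m - 2) hfin.toFinset hc
  refine ⟨fun i => x (i - 1), ?_, ?_, ?_⟩
  · intro i hi him
    exact hAS (by simpa using h1 (i - 1) (by omega))
  · intro i j hi hij hj
    exact h2 _ _ (by omega) (by omega)
  · intro i hi him
    obtain ⟨i, rfl⟩ := Nat.exists_eq_add_of_le' hi
    simpa using h3 i (by omega)
end

section
/- Let δ ∈ (0,π) and set m := ⌊2/(1 − cos(δ/2))⌋ + 2. Then any collection of m − 1 unit vectors v₁,…,v_{m−1} in ℝ³ contains two indices i ≠ j such that the angle between v_i and v_j (namely arccos⟨v_i, v_j⟩) is at most δ. -/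
open Real InnerProductGeometry

open MeasureTheory in
/-- Volume of a spherical sector in cylindrical coordinates (lower bound). -/
lemma sector_volume (c : ℝ) (h0 : 0 < c) (h1 : c < 1) :
    ENNReal.ofReal (2 * π * (1 - c) / 3) ≤
      volume {p : ℝ × EuclideanSpace ℝ (Fin 2) |
        p.1 ^ 2 + ‖p.2‖ ^ 2 < 1 ∧ c ^ 2 * (p.1 ^ 2 + ‖p.2‖ ^ 2) < p.1 ^ 2 ∧ 0 < p.1} := by
  set T := {p : ℝ × EuclideanSpace ℝ (Fin 2) |
        p.1 ^ 2 + ‖p.2‖ ^ 2 < 1 ∧ c ^ 2 * (p.1 ^ 2 + ‖p.2‖ ^ 2) < p.1 ^ 2 ∧ 0 < p.1} with hT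
  have hTm : MeasurableSet T := by
    apply IsOpen.measurableSet
    refine IsOpen.and ?_ (IsOpen.and ?_ ?_) <;>
      exact isOpen_lt (by fun_prop) (by fun_prop)
  let R : ℝ → ℝ := fun z => min (z ^ 2 * (1 / c ^ 2 - 1)) (1 - z ^ 2)
  have hRc : Continuous R := by fun_prop
  have hc2 : 0 < c ^ 2 := by positivity
  have hk : 0 < 1 / c ^ 2 - 1 := by
    rw [sub_pos, lt_div_iff₀ hc2]; nlinarith
  have hR0 : ∀ z ∈ Set.Ioc (0 : ℝ) 1, 0 ≤ R z := by
    intro z hz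
    refine le_min (by positivity) ?_
    nlinarith [hz.1, hz.2]
  have hslice : ∀ z ∈ Set.Ioc (0 : ℝ) 1,
      ENNReal.ofReal (π * R z) ≤ volume (Prod.mk z ⁻¹' T) := by
    intro z hz
    have hsub : Metric.ball (0 : EuclideanSpace ℝ (Fin 2)) (√(R z)) ⊆ Prod.mk z ⁻¹' T := by
      intro y hy
      rw [mem_ball_zero_iff, Real.lt_sqrt (norm_nonneg _)] at hy
      obtain ⟨ha, hb⟩ := lt_min_iff.1 hy
      refine ⟨by simp only; linarith, ?_, hz.1⟩
      simp only
      have h3 : c ^ 2 * ‖y‖ ^ 2 < c ^ 2 * (z ^ 2 * (1 / c ^ 2 - 1)) := by gcongr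
      have h4 : c ^ 2 * (z ^ 2 * (1 / c ^ 2 - 1)) = z ^ 2 - c ^ 2 * z ^ 2 := by
        field_simp
      nlinarith
    refine le_trans (le_of_eq ?_) (measure_mono hsub)
    rw [EuclideanSpace.volume_ball_fin_two, ← ENNReal.ofReal_pow (Real.sqrt_nonneg _),
      Real.sq_sqrt (hR0 z hz), ← ENNReal.ofReal_mul (hR0 z hz), mul_comm]
  have hint : ∫ z in (0 : ℝ)..1, π * R z = 2 * π * (1 - c) / 3 := by
    have hII : ∀ a b : ℝ, IntervalIntegrable (fun z => π * R z) volume a b := fun a b =>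
      (by fun_prop : Continuous fun z => π * R z).intervalIntegrable a b
    rw [← intervalIntegral.integral_add_adjacent_intervals (hII 0 c) (hII c 1)]
    have e1 : ∫ z in (0 : ℝ)..c, π * R z = ∫ z in (0 : ℝ)..c, (π * (1 / c ^ 2 - 1)) * z ^ 2 := by
      apply intervalIntegral.integral_congr
      intro z hz
      rw [Set.uIcc_of_le h0.le] at hz
      have hzc : z ^ 2 ≤ c ^ 2 := by nlinarith [hz.1, hz.2]
      have : z ^ 2 * (1 / c ^ 2 - 1) ≤ 1 - z ^ 2 := by
        have : z ^ 2 * (1 / c ^ 2) ≤ 1 := by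
          rw [mul_one_div, div_le_one hc2]; exact hzc
        linarith
      simp only [R, min_eq_left this]
      ring
    have e2 : ∫ z in c..1, π * R z = ∫ z in c..1, (π - π * z ^ 2) := by
      apply intervalIntegral.integral_congr
      intro z hz
      rw [Set.uIcc_of_le h1.le] at hz
      have hzc : c ^ 2 ≤ z ^ 2 := by nlinarith [hz.1, hz.2]
      have : 1 - z ^ 2 ≤ z ^ 2 * (1 / c ^ 2 - 1) := by
        have : 1 ≤ z ^ 2 * (1 / c ^ 2) := by
          rw [mul_one_div, one_le_div hc2]; exact hzc
        linarith
      simp only [R, min_eq_right this]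
      ring
    rw [e1, e2, intervalIntegral.integral_const_mul, intervalIntegral.integral_sub
      (by simp) (by apply Continuous.intervalIntegrable; fun_prop),
      intervalIntegral.integral_const_mul, integral_pow, integral_pow,
      intervalIntegral.integral_const]
    simp only [smul_eq_mul]
    push_cast
    field_simp
    ring
  rw [Measure.volume_eq_prod, Measure.prod_apply hTm]
  calc ENNReal.ofReal (2 * π * (1 - c) / 3)
      = ∫⁻ z in Set.Ioc (0 : ℝ) 1, ENNReal.ofReal (π * R z) := by
        rw [← hint, intervalIntegral.integral_of_le zero_le_one,
          ofReal_integral_eq_lintegral_ofReal]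
        · exact (by fun_prop : Continuous fun z => π * R z).integrableOn_Ioc
        · refine (ae_restrict_iff' measurableSet_Ioc).2 (Filter.Eventually.of_forall ?_)
          intro z hz
          exact mul_nonneg pi_pos.le (hR0 z hz)
    _ ≤ ∫⁻ z in Set.Ioc (0 : ℝ) 1, volume (Prod.mk z ⁻¹' T) :=
        setLIntegral_mono' measurableSet_Ioc hslice
    _ ≤ _ := setLIntegral_le_lintegral _ _

/-- A linear isometry sending a given unit vector to the first axis. -/
lemma exists_iso (v : EuclideanSpace ℝ (Fin 3)) (hv : ‖v‖ = 1) :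
    ∃ e : EuclideanSpace ℝ (Fin 3) ≃ₗᵢ[ℝ] WithLp 2 (ℝ × EuclideanSpace ℝ (Fin 2)),
      e v = WithLp.toLp 2 (1, 0) := by
  have hfr : Module.finrank ℝ (EuclideanSpace ℝ (Fin 3)) =
      Module.finrank ℝ (WithLp 2 (ℝ × EuclideanSpace ℝ (Fin 2))) := by
    rw [(WithLp.linearEquiv 2 ℝ (ℝ × EuclideanSpace ℝ (Fin 2))).finrank_eq]
    simp
  let e₀ := (stdOrthonormalBasis ℝ (EuclideanSpace ℝ (Fin 3))).equiv
    (stdOrthonormalBasis ℝ (WithLp 2 (ℝ × EuclideanSpace ℝ (Fin 2)))) (finCongr hfr)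
  let w : WithLp 2 (ℝ × EuclideanSpace ℝ (Fin 2)) := WithLp.toLp 2 (1, 0)
  have hw : ‖w‖ = 1 := by
    have h2 : ‖w‖ ^ 2 = 1 := by
      rw [WithLp.prod_norm_sq_eq_of_L2]
      simp [w]
    nlinarith [norm_nonneg w]
  refine ⟨e₀.trans (Submodule.reflection (Submodule.span ℝ {e₀ v - w})ᗮ), ?_⟩
  exact Submodule.reflection_sub (by rw [e₀.norm_map, hv, hw])

/-- The open spherical sector. -/
def sector (c : ℝ) (v : EuclideanSpace ℝ (Fin 3)) : Set (EuclideanSpace ℝ (Fin 3)) :=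
  {x | ‖x‖ < 1 ∧ c * ‖x‖ < inner ℝ v x}

open MeasureTheory in
lemma sector_vol (c : ℝ) (h0 : 0 < c) (h1 : c < 1)
    (v : EuclideanSpace ℝ (Fin 3)) (hv : ‖v‖ = 1) :
    ENNReal.ofReal (2 * π * (1 - c) / 3) ≤ volume (sector c v) := by
  obtain ⟨e, he⟩ := exists_iso v hv
  have hmp := (WithLp.volume_preserving_ofLp ℝ (EuclideanSpace ℝ (Fin 2))).comp
    e.measurePreserving
  refine (sector_volume c h0 h1).trans ?_
  rw [← hmp.measure_preimage]
  · apply measure_mono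
    rintro x ⟨ha, hb, hc⟩
    have hn : ‖x‖ ^ 2 = (e x).fst ^ 2 + ‖(e x).snd‖ ^ 2 := by
      rw [← e.norm_map, WithLp.prod_norm_sq_eq_of_L2]; simp
    have hi : inner ℝ v x = (e x).fst := by
      rw [← e.inner_map_map, he, WithLp.prod_inner_apply]; simp
    change (e x).fst ^ 2 + ‖(e x).snd‖ ^ 2 < 1 at ha
    change c ^ 2 * ((e x).fst ^ 2 + ‖(e x).snd‖ ^ 2) < (e x).fst ^ 2 at hb
    change 0 < (e x).fst at hc
    rw [← hn] at ha hb
    refine ⟨by nlinarith [norm_nonneg x], ?_⟩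
    rw [hi]
    apply lt_of_pow_lt_pow_left₀ 2 hc.le
    rw [mul_pow]; exact hb
  · apply MeasurableSet.nullMeasurableSet
    apply IsOpen.measurableSet
    refine IsOpen.and ?_ (IsOpen.and ?_ ?_) <;>
      exact isOpen_lt (by fun_prop) (by fun_prop)

lemma sector_angle (δ : ℝ) (hδ : δ ∈ Set.Ioo 0 π) (v x : EuclideanSpace ℝ (Fin 3))
    (hv : ‖v‖ = 1) (hx : x ∈ sector (Real.cos (δ / 2)) v) : angle v x < δ / 2 := by
  have hx0 : 0 < ‖x‖ := by
    rw [norm_pos_iff]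
    rintro rfl
    have := hx.2
    simp at this
  by_contra h
  push Not at h
  have h2 := Real.cos_le_cos_of_nonneg_of_le_pi (by linarith [hδ.1]) (angle_le_pi v x) h
  rw [cos_angle, hv, one_mul, div_le_iff₀ hx0] at h2
  exact absurd hx.2 (not_lt.2 h2)

open MeasureTheory in
/-- packing on the 2-sphere — with `m = ⌊2 / (1 − cos(δ/2))⌋ + 2`, any `m − 1`
unit vectors in ℝ³ contain two whose angle is at most `δ`. -/
theorem stmt9 (δ : ℝ) (hδ : δ ∈ Set.Ioo 0 π) (m : ℕ)
    (hm : m = ⌊2 / (1 - Real.cos (δ / 2))⌋₊ + 2)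
    (v : Fin (m - 1) → EuclideanSpace ℝ (Fin 3)) (hv : ∀ i, ‖v i‖ = 1) :
    ∃ i j, i ≠ j ∧ InnerProductGeometry.angle (v i) (v j) ≤ δ := by
  by_contra! hcon
  set c := Real.cos (δ / 2) with hc
  have h0 : 0 < c := Real.cos_pos_of_mem_Ioo ⟨by linarith [hδ.1, pi_pos], by linarith [hδ.2]⟩
  have h1 : c < 1 := by
    rw [hc, ← Real.cos_zero]
    exact Real.cos_lt_cos_of_nonneg_of_le_pi le_rfl (by linarith [hδ.1, hδ.2]) (by linarith [hδ.1])
  have hN : 2 < ((m - 1 : ℕ) : ℝ) * (1 - c) := by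
    have h := Nat.lt_floor_add_one (2 / (1 - c))
    rw [div_lt_iff₀ (by linarith)] at h
    have : m - 1 = ⌊2 / (1 - c)⌋₊ + 1 := by omega
    rw [this]
    push_cast
    exact h
  have hdisj : Pairwise (Function.onFun Disjoint fun i => sector c (v i)) := by
    intro i j hij
    rw [Function.onFun, Set.disjoint_left]
    intro x hxi hxj
    have a := sector_angle δ hδ _ x (hv i) hxi
    have b := sector_angle δ hδ _ x (hv j) hxj
    have t := angle_le_angle_add_angle (v i) x (v j)
    rw [angle_comm x] at t
    linarith [hcon i j hij]
  have hmeas : ∀ i, MeasurableSet (sector c (v i)) := by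
    intro i
    apply IsOpen.measurableSet
    refine IsOpen.and ?_ ?_ <;> exact isOpen_lt (by fun_prop) (by fun_prop)
  have hsub : (⋃ i, sector c (v i)) ⊆ Metric.ball 0 1 := by
    refine Set.iUnion_subset fun i x hx => ?_
    rw [mem_ball_zero_iff]
    exact hx.1
  have hle := measure_mono (μ := volume) hsub
  rw [measure_iUnion hdisj hmeas, tsum_fintype, EuclideanSpace.volume_ball_fin_three] at hle
  have hle2 := (Finset.sum_le_sum fun i (_ : i ∈ Finset.univ) =>
    sector_vol c h0 h1 (v i) (hv i)).trans hle
  rw [Finset.sum_const, Finset.card_univ, Fintype.card_fin, nsmul_eq_mul,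
    ← ENNReal.ofReal_natCast, ← ENNReal.ofReal_mul (by positivity), ENNReal.ofReal_one, one_pow,
    one_mul, ENNReal.ofReal_le_ofReal_iff (by positivity)] at hle2
  nlinarith [pi_pos, mul_pos pi_pos (sub_pos.2 hN)]
end

section
/- Let ε ∈ (0,π) and set m := ⌊2/(1 − cos((π−ε)/4))⌋ + 2. Then every subset S of Euclidean ℝ³ with |S| ≥ 2·(2·25³)^{m−2} contains three pairwise distinct points x, y, z such that ∠xyz > ε, where ∠xyz is the Euclidean angle at y. -/
open Real EuclideanGeometry

lemma exists_idx : ∃ idx : EuclideanSpace ℝ (Fin 3) → Fin 3,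
    ∀ v, idx (-v) = idx v ∧ ∀ j, |v j| ≤ |v (idx v)| := by
  classical
  refine ⟨fun v => if |v 1| ≤ |v 0| ∧ |v 2| ≤ |v 0| then 0 else
    if |v 0| ≤ |v 1| ∧ |v 2| ≤ |v 1| then 1 else 2, fun v => ⟨by simp, fun j => ?_⟩⟩
  dsimp only
  split_ifs with h1 h2
  · fin_cases j
    · exact le_rfl
    · exact h1.1
    · exact h1.2
  · fin_cases j
    · exact h2.1
    · exact le_rfl
    · exact h2.2
  · have h3 : |v 0| ≤ |v 2| ∧ |v 1| ≤ |v 2| := by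
      rcases le_total (|v 0|) (|v 1|) with ha | ha <;>
      rcases le_total (|v 0|) (|v 2|) with hb | hb <;>
      rcases le_total (|v 1|) (|v 2|) with hc | hc <;>
      constructor <;> first | assumption | (exfalso; tauto) | linarith
    fin_cases j
    · exact h3.1
    · exact h3.2
    · exact le_rfl

lemma quant (n : ℕ) (hn : 0 < n) : ∃ q : ℝ → Fin (n + 1), ∀ s t : ℝ, |s| ≤ 1 → |t| ≤ 1 →
    q s = q t → |s - t| ≤ 2 / n := by
  have hnR : (0 : ℝ) < n := by exact_mod_cast hn
  have key : ∀ s : ℝ, |s| ≤ 1 → ⌊(s + 1) / 2 * n⌋₊ < n + 1 := by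
    intro s hs
    have := abs_le.1 hs
    rw [Nat.floor_lt (by have : 0 ≤ s + 1 := by linarith
                         positivity)]
    push_cast
    nlinarith
  refine ⟨fun s => Fin.ofNat (n + 1) ⌊(s + 1) / 2 * n⌋₊, fun s t hs ht h => ?_⟩
  have hfl : ⌊(s + 1) / 2 * n⌋₊ = ⌊(t + 1) / 2 * n⌋₊ := by
    have := congrArg Fin.val h
    simpa [Fin.ofNat, Nat.mod_eq_of_lt (key s hs), Nat.mod_eq_of_lt (key t ht)] using this
  have hs1 := abs_le.1 hs
  have ht1 := abs_le.1 ht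
  have s0 : 0 ≤ (s + 1) / 2 * n := by
    have : 0 ≤ s + 1 := by linarith
    positivity
  have t0 : 0 ≤ (t + 1) / 2 * n := by
    have : 0 ≤ t + 1 := by linarith
    positivity
  have a1 := Nat.floor_le s0
  have a2 := Nat.lt_floor_add_one ((s + 1) / 2 * n)
  have b1 := Nat.floor_le t0
  have b2 := Nat.lt_floor_add_one ((t + 1) / 2 * n)
  rw [hfl] at a1 a2
  rw [abs_le, neg_le, le_div_iff₀ hnR, le_div_iff₀ hnR]
  constructor <;> nlinarith

lemma cos_bound (a b : EuclideanSpace ℝ (Fin 3)) (i : Fin 3) (r : ℝ)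
    (ha : a i = 1) (hb : b i = 1) (h1 : |a (i+1) - b (i+1)| ≤ r) (h2 : |a (i+2) - b (i+2)| ≤ r) :
    1 - r ^ 2 ≤ Real.cos (InnerProductGeometry.angle a b) := by
  have na : 1 ≤ ‖a‖ := by simpa [ha] using PiLp.norm_apply_le a i
  have nb : 1 ≤ ‖b‖ := by simpa [hb] using PiLp.norm_apply_le b i
  have hd : ‖a - b‖ ^ 2 ≤ 2 * r ^ 2 := by
    have e : ‖a - b‖ ^ 2 = (a i - b i) ^ 2 + (a (i+1) - b (i+1)) ^ 2 + (a (i+2) - b (i+2)) ^ 2 := by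
      rw [EuclideanSpace.norm_sq_eq, Fin.sum_univ_three]
      simp only [PiLp.sub_apply, Real.norm_eq_abs, sq_abs]
      fin_cases i <;> simp <;> ring
    rw [e, ha, hb]
    have := sq_le_sq' (abs_le.1 h1).1 (abs_le.1 h1).2
    have := sq_le_sq' (abs_le.1 h2).1 (abs_le.1 h2).2
    linarith
  have hi := norm_sub_sq_real a b
  rw [InnerProductGeometry.cos_angle, le_div_iff₀ (by positivity)]
  have : 1 ≤ ‖a‖ * ‖b‖ := one_le_mul_of_one_le_of_one_le na nb
  nlinarith [sq_nonneg (‖a‖ - ‖b‖), sq_nonneg r]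

lemma color (n : ℕ) (hn : 0 < n) : ∃ (idx : EuclideanSpace ℝ (Fin 3) → Fin 3)
    (col : EuclideanSpace ℝ (Fin 3) → Fin 3 × Fin (n+1) × Fin (n+1)),
    (∀ v, (col v).1 = idx v) ∧ (∀ v, col (-v) = col v) ∧ (∀ v : EuclideanSpace ℝ (Fin 3), v ≠ 0 → v (idx v) ≠ 0) ∧
    ∀ v w, col v = col w → 0 < v (idx v) → 0 < w (idx w) →
      1 - (2 / n : ℝ) ^ 2 ≤ Real.cos (InnerProductGeometry.angle v w) := by
  obtain ⟨idx, hidx⟩ := exists_idx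
  obtain ⟨q, hq⟩ := quant n hn
  refine ⟨idx, fun v => (idx v, q (v (idx v + 1) / v (idx v)), q (v (idx v + 2) / v (idx v))),
    fun v => rfl, fun v => ?_, fun v hv h0 => ?_, fun v w h hv hw => ?_⟩
  · simp [(hidx v).1, neg_div_neg_eq]
  · apply hv
    ext j
    have := (hidx v).2 j
    rw [h0] at this
    simpa using this
  · simp only [Prod.mk.injEq] at h
    obtain ⟨e, e1, e2⟩ := h
    have bv := (hidx v).2
    have bw := (hidx w).2
    rw [← e] at bw e1 e2 hw
    generalize idx v = i at *
    have B : ∀ (u : EuclideanSpace ℝ (Fin 3)), 0 < u i → (∀ j, |u j| ≤ |u i|) →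
        ∀ j, |u j / u i| ≤ 1 := by
      intro u hu hb j
      rw [abs_div]
      exact div_le_one_of_le₀ (hb j) (abs_nonneg _)
    rw [← InnerProductGeometry.angle_smul_left_of_pos v w (inv_pos.2 hv),
      ← InnerProductGeometry.angle_smul_right_of_pos _ w (inv_pos.2 hw)]
    apply cos_bound _ _ i
    · simp [hv.ne']
    · simp [hw.ne']
    · have := hq _ _ (B v hv bv _) (B w hw bw _) e1
      simpa [div_eq_inv_mul] using this
    · have := hq _ _ (B v hv bv _) (B w hw bw _) e2
      simpa [div_eq_inv_mul] using this

lemma card_bound (n : ℕ) (hn : 0 < n) (S : Set (EuclideanSpace ℝ (Fin 3)))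
    (H : ∀ x ∈ S, ∀ y ∈ S, ∀ z ∈ S, x ≠ y → y ≠ z → x ≠ z →
      Real.cos (InnerProductGeometry.angle (y - x) (z - y)) < 1 - (2 / n : ℝ) ^ 2) :
    S.encard ≤ ((2 ^ (3 * (n + 1) ^ 2) : ℕ) : ℕ∞) := by
  classical
  obtain ⟨idx, col, hc, hneg, h0, hcos⟩ := color n hn
  let A : S → (Fin 3 × Fin (n+1) × Fin (n+1)) → Bool := fun x c =>
    decide (∃ y ∈ S, col (y - x) = c ∧ 0 < (y - x.1) (idx (y - x)))
  have main : ∀ x y : S, 0 < (y.1 - x.1) (idx (y.1 - x)) → A x ≠ A y := by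
    intro x y hpos hA
    have h1 : A x (col (y.1 - x)) = true := by
      simp only [A, decide_eq_true_eq]
      exact ⟨y, y.2, rfl, hpos⟩
    rw [hA] at h1
    simp only [A, decide_eq_true_eq] at h1
    obtain ⟨z, hz, hcz, hpz⟩ := h1
    have hi : idx (z - y) = idx (y.1 - x) := by rw [← hc, ← hc, hcz]
    have := hcos _ _ hcz.symm hpos hpz
    refine absurd (H x x.2 y y.2 z hz ?_ ?_ ?_) (not_lt.2 this)
    · intro e
      rw [e] at hpos
      simp at hpos
    · intro e
      rw [e] at hpz
      simp at hpz
    · intro e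
      rw [hi] at hpz
      rw [← e] at hpz
      simp only [PiLp.sub_apply] at hpz hpos
      linarith
  have inj : Function.Injective A := by
    intro x y hxy
    by_contra hne
    have hneR : y.1 - x.1 ≠ 0 := fun h => hne (Subtype.ext (sub_eq_zero.1 h).symm)
    rcases lt_or_gt_of_ne (h0 _ hneR) with h | h
    · refine main y x ?_ hxy.symm
      have e : idx (x.1 - y.1) = idx (y.1 - x.1) := by
        rw [← hc, ← hc, ← hneg, neg_sub]
      rw [e]
      simp only [PiLp.sub_apply] at h ⊢
      linarith
    · exact main x y h hxy
  have fin : Finite S := Finite.of_injective A inj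
  have hcard := Nat.card_le_card_of_injective A inj
  have hfs : S.Finite := fin
  rw [← hfs.cast_ncard_eq]
  rw [Nat.card_coe_set_eq] at hcard
  refine Nat.cast_le.2 (hcard.trans (le_of_eq ?_))
  simp [Nat.card_eq_fintype_card]
  ring

/-- with `m = ⌊2/(1 − cos((π−ε)/4))⌋ + 2`, every subset of ℝ³ of cardinality
at least `2·(2·25³)^(m−2)` contains three distinct points subtending an angle `> ε`. -/
theorem stmt13 (ε : ℝ) (hε : ε ∈ Set.Ioo 0 π) (m : ℕ)
    (hm : m = ⌊2 / (1 - Real.cos ((π - ε) / 4))⌋₊ + 2)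
    (S : Set (EuclideanSpace ℝ (Fin 3)))
    (hS : (2 * (2 * 25 ^ 3) ^ (m - 2) : ℕ∞) ≤ S.encard) :
    ∃ x ∈ S, ∃ y ∈ S, ∃ z ∈ S, x ≠ y ∧ y ≠ z ∧ x ≠ z ∧
      EuclideanGeometry.angle x y z > ε := by
  by_contra hcon
  push Not at hcon
  obtain ⟨he0, heπ⟩ := hε
  obtain ⟨θ, hθ⟩ : ∃ θ, θ = (π - ε) / 4 := ⟨_, rfl⟩
  rw [← hθ] at hm
  have hπ := Real.pi_lt_d2
  have hπ3 := Real.pi_gt_three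
  have θ0 : 0 < θ := by rw [hθ]; linarith
  have θ1 : θ < 0.7875 := by rw [hθ]; linarith
  obtain ⟨n, hnd⟩ : ∃ n, n = ⌈(3 / 2) / θ⌉₊ := ⟨_, rfl⟩
  have hn1 : (3 / 2) / θ ≤ n := hnd ▸ Nat.le_ceil _
  have hn2 : (n : ℝ) < (3 / 2) / θ + 1 := hnd ▸ Nat.ceil_lt_add_one (by positivity)
  have hnpos : (0 : ℝ) < n := lt_of_lt_of_le (by positivity) hn1
  have hn : 0 < n := by exact_mod_cast hnpos
  have hr : (2 / n : ℝ) ≤ 4 / 3 * θ := by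
    rw [div_le_iff₀ θ0] at hn1
    rw [div_le_iff₀ hnpos]
    linarith
  have hcosθ : Real.cos (4 * θ) < 1 - (2 / n : ℝ) ^ 2 := by
    have h1 : Real.cos (4 * θ) ≤ 1 - 2 / π ^ 2 * (4 * θ) ^ 2 := by
      apply Real.cos_le_one_sub_mul_cos_sq
      rw [abs_of_pos (by positivity), hθ]
      linarith
    have h2 : (2 / n : ℝ) ^ 2 ≤ (4 / 3 * θ) ^ 2 := by gcongr
    have h3 : (1 / 9 : ℝ) < 2 / π ^ 2 := by
      rw [lt_div_iff₀ (by positivity)]; nlinarith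
    nlinarith [mul_pos θ0 θ0]
  have hb := card_bound n hn S (by
    intro x hx y hy z hz hxy hyz hxz
    have h := hcon x hx y hy z hz hxy hyz hxz
    have h2 : Real.cos ε ≤ Real.cos (EuclideanGeometry.angle x y z) :=
      Real.cos_le_cos_of_nonneg_of_le_pi (InnerProductGeometry.angle_nonneg _ _) heπ.le h
    have h3 : EuclideanGeometry.angle x y z
        = π - InnerProductGeometry.angle (y - x) (z - y) := by
      rw [← InnerProductGeometry.angle_neg_left, neg_sub]; rfl
    have h4 : ε = π - 4 * θ := by rw [hθ]; ring
    rw [h3, h4, Real.cos_pi_sub, Real.cos_pi_sub] at h2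
    linarith)
  have hle := hS.trans hb
  have hleN : 2 * (2 * 25 ^ 3) ^ (m - 2) ≤ 2 ^ (3 * (n + 1) ^ 2) := by exact_mod_cast hle
  have hk : 3 * (n + 1) ^ 2 ≤ 14 * (m - 2) := by
    have hm2 : m - 2 = ⌊2 / (1 - Real.cos θ)⌋₊ := by omega
    have hf := Nat.lt_floor_add_one (2 / (1 - Real.cos θ))
    rw [← hm2] at hf
    have hc1 : 0 < 1 - Real.cos θ := by
      have := Real.cos_lt_cos_of_nonneg_of_le_pi le_rfl (by linarith : θ ≤ π) θ0
      rw [Real.cos_zero] at this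
      linarith
    have hc2 := Real.one_sub_sq_div_two_le_cos (x := θ)
    have hX : 4 / θ ^ 2 ≤ 2 / (1 - Real.cos θ) := by
      rw [div_le_div_iff₀ (by positivity) hc1]
      linarith
    have hn3 : (n : ℝ) + 1 ≤ 3.1 / θ := by
      have : 2 ≤ 1.6 / θ := by rw [le_div_iff₀ θ0]; linarith
      have : (3.1 : ℝ) / θ = (3 / 2) / θ + 1.6 / θ := by ring
      linarith
    have hn4 : ((n : ℝ) + 1) ^ 2 ≤ (3.1 / θ) ^ 2 := by gcongr
    have h5 : (1 : ℝ) ≤ 1 / θ ^ 2 := by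
      rw [le_div_iff₀ (by positivity)]; nlinarith
    have h6 : (3.1 / θ) ^ 2 = 9.61 * (1 / θ ^ 2) := by ring
    have h7 : 4 / θ ^ 2 = 4 * (1 / θ ^ 2) := by ring
    have : (3 * ((n : ℝ) + 1) ^ 2) ≤ 14 * ((m - 2 : ℕ) : ℝ) := by linarith
    exact_mod_cast this
  have h8 : 2 ^ (3 * (n + 1) ^ 2) ≤ 2 ^ (14 * (m - 2)) := Nat.pow_le_pow_right (by norm_num) hk
  have h9 : 2 ^ (14 * (m - 2)) ≤ (2 * 25 ^ 3) ^ (m - 2) := by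
    rw [pow_mul]
    exact Nat.pow_le_pow_left (by norm_num) _
  have h10 : 0 < (2 * 25 ^ 3) ^ (m - 2) := by positivity
  omega
end

section
/- For every n ∈ ℕ and every ε ∈ (0,π) there exists B ∈ ℕ such that every subset S of Euclidean ℝⁿ with |S| ≥ B contains three pairwise distinct points x, y, z with ∠xyz > ε. Equivalently, any subset of ℝⁿ in which every angle subtended at one of its points by two others is at most ε has fewer than B points. -/
open Real EuclideanGeometry

theorem stmt14_cover (n : ℕ) (δ : ℝ) (hδ : 0 < δ) :
    ∃ t : Finset (EuclideanSpace ℝ (Fin n)), ∀ v : EuclideanSpace ℝ (Fin n), v ≠ 0 →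
      ∃ c ∈ t, InnerProductGeometry.angle c v < δ := by
  obtain ⟨t, -, ht⟩ := (isCompact_sphere (0 : EuclideanSpace ℝ (Fin n)) 1).elim_nhds_subcover'
    (fun u _ => {v | InnerProductGeometry.angle u v < δ}) (by
      intro u hu
      have hu0 : u ≠ 0 := by
        rintro rfl
        simp at hu
      have hc : ContinuousAt (fun v => InnerProductGeometry.angle u v) u :=
        (InnerProductGeometry.continuousAt_angle (x := (u, u)) hu0 hu0).comp
          (f := fun v => (u, v)) (by fun_prop)
      exact hc.eventually_lt continuousAt_const
        (by simpa [InnerProductGeometry.angle_self hu0] using hδ)) |>.imp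
          fun t ht => And.intro trivial ht
  classical
  refine ⟨t.image Subtype.val, fun v hv => ?_⟩
  have hn : 0 < ‖v‖⁻¹ := by positivity
  have hm : ‖v‖⁻¹ • v ∈ Metric.sphere (0 : EuclideanSpace ℝ (Fin n)) 1 := by
    simp [norm_smul, hv]
  obtain ⟨c, hc, hcv⟩ := Set.mem_iUnion₂.1 (ht hm)
  refine ⟨c, Finset.mem_image_of_mem _ hc, ?_⟩
  simpa [InnerProductGeometry.angle_smul_right_of_pos _ _ hn] using hcv

/-- for every `n` and `ε ∈ (0, π)` there is `B ∈ ℕ` such that every subset of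
Euclidean ℝⁿ with at least `B` points contains three distinct points subtending an angle
greater than `ε`. -/
theorem stmt14 (n : ℕ) (ε : ℝ) (hε : ε ∈ Set.Ioo 0 π) :
    ∃ B : ℕ, ∀ S : Set (EuclideanSpace ℝ (Fin n)), (B : ℕ∞) ≤ S.encard →
      ∃ x ∈ S, ∃ y ∈ S, ∃ z ∈ S, x ≠ y ∧ y ≠ z ∧ x ≠ z ∧
        EuclideanGeometry.angle x y z > ε := by
  classical
  obtain ⟨h0, h1⟩ := hε
  obtain ⟨t, ht⟩ := stmt14_cover n ((π - ε) / 2) (by linarith)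
  refine ⟨t.powerset.card + 1, fun S hS => ?_⟩
  obtain ⟨T, hTS, hT⟩ := Set.exists_subset_encard_eq hS
  have hTf : T.Finite := Set.finite_of_encard_eq_coe hT
  have hcard : t.powerset.card < hTf.toFinset.card := by
    rw [hTf.encard_eq_coe_toFinset_card] at hT
    have : hTf.toFinset.card = t.powerset.card + 1 := by exact_mod_cast hT
    omega
  -- the set of cones met by directions from `x` to other points
  obtain ⟨x, hx, y, hy, hxy, hF⟩ := Finset.exists_ne_map_eq_of_card_lt_of_maps_to hcard
    (f := fun x => t.filter fun c => ∃ z ∈ S, z ≠ x ∧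
      InnerProductGeometry.angle c (z - x) < (π - ε) / 2)
    (fun x _ => Finset.mem_coe.2 (Finset.mem_powerset.2 (Finset.filter_subset _ _)))
  have hxS : x ∈ S := hTS (by simpa using hx)
  have hyS : y ∈ S := hTS (by simpa using hy)
  obtain ⟨c, hc, hcxy⟩ := ht (y - x) (sub_ne_zero.2 hxy.symm)
  have hmem : c ∈ t.filter fun c => ∃ z ∈ S, z ≠ x ∧
      InnerProductGeometry.angle c (z - x) < (π - ε) / 2 :=
    Finset.mem_filter.2 ⟨hc, y, hyS, hxy.symm, hcxy⟩
  rw [hF] at hmem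
  obtain ⟨-, z, hzS, hzy, hcz⟩ := Finset.mem_filter.1 hmem
  have htri := InnerProductGeometry.angle_le_angle_add_angle (y - x) c (z - y)
  rw [InnerProductGeometry.angle_comm (y - x) c] at htri
  refine ⟨x, hxS, y, hyS, z, hzS, hxy, hzy.symm, ?_, ?_⟩
  · rintro rfl
    rw [← neg_sub y x, InnerProductGeometry.angle_self_neg_of_nonzero
      (sub_ne_zero.2 hxy.symm), neg_sub] at htri
    linarith
  · have : EuclideanGeometry.angle x y z
        = π - InnerProductGeometry.angle (y - x) (z - y) := by
      rw [EuclideanGeometry.angle, vsub_eq_sub, vsub_eq_sub, ← neg_sub y x,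
        InnerProductGeometry.angle_neg_left]
    rw [this]
    linarith
end
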